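/- Let A = A_1 ⊕ ... ⊕ A_m be a semisimple C-algebra with simple summands A_i. Then for each i, the projection P_i : A → A of A onto A_i along ⊕_{j≠i} A_j lies in E_A. -/

import Mathlib

/-- Data of a linear operad: spaces of `n`-ary operations, an identity operation,
and partial compositions. -/
structure LinearOperadData (F : Type) [Field F] where
  C : ℕ → Type
  one : C 1
  comp : ∀ {m n : ℕ}, C m → C n → Fin m → C (m + n - 1)

/-- An algebra over (the data of) a linear operad: structure maps
`α n : C n → MultilinearMap`, compatible with identity and composition. -/
structure OperadAlgebraOn (F : Type) [Field F] (O : LinearOperadData F)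
    (A : Type) [AddCommGroup A] [Module F A] where
  α : ∀ n, O.C n → MultilinearMap F (fun _ : Fin n => A) A
  α_one : ∀ a : A, α 1 O.one (fun _ => a) = a
  α_comp : ∀ {m n : ℕ} (c : O.C m) (d : O.C n) (i : Fin m) (v : Fin (m + n - 1) → A),
    α (m + n - 1) (O.comp c d i) v =
      α m c (fun k =>
        if hk : (k : ℕ) < (i : ℕ) then v ⟨k, by have := k.isLt; have := i.isLt; omega⟩
        else if hk2 : (k : ℕ) = (i : ℕ) then
          α n d (fun j => v ⟨(i : ℕ) + (j : ℕ), by have := j.isLt; have := i.isLt; omega⟩)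
        else v ⟨(k : ℕ) + n - 1, by have := k.isLt; have := i.isLt; omega⟩)

variable {F : Type} [Field F] {O : LinearOperadData F}
variable {A : Type} [AddCommGroup A] [Module F A]

/-- The partial multiplication operator `a ↦ α n c (v_1,...,a at slot j,...,v_{n-1})`. -/
def OperadAlgebraOn.op (OA : OperadAlgebraOn F O A) {n : ℕ} (c : O.C n)
    (v : Fin n → A) (j : Fin n) : Module.End F A :=
  (OA.α n c).toLinearMap v j

/-- `E_A`: the span of the partial multiplication operators with `n ≥ 2` inputs. -/
def EA (OA : OperadAlgebraOn F O A) : Submodule F (Module.End F A) :=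
  Submodule.span F
    {T | ∃ n : ℕ, 2 ≤ n ∧ ∃ (c : O.C n) (v : Fin n → A) (j : Fin n), T = OA.op c v j}

/-- `L_A`: the image of `C(1)` in `End_F(A)`. -/
def LA (OA : OperadAlgebraOn F O A) : Submodule F (Module.End F A) :=
  Submodule.span F {T | ∃ c : O.C 1, T = OA.op c (fun _ => (0 : A)) 0}

/-- `R_A = L_A + E_A`. -/
def RA (OA : OperadAlgebraOn F O A) : Submodule F (Module.End F A) :=
  LA OA ⊔ EA OA

/-- A subspace `I ⊆ A` is an ideal: closed under all operadic operations whenever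
at least one argument lies in `I`. -/
def IsIdealPred (OA : OperadAlgebraOn F O A) (I : Submodule F A) : Prop :=
  ∀ (n : ℕ) (c : O.C n) (v : Fin n → A) (j : Fin n), v j ∈ I → OA.α n c v ∈ I

/-- A relative ideal `J` of the subalgebra `P ⊆ A`. -/
def IsIdealIn (OA : OperadAlgebraOn F O A) (P J : Submodule F A) : Prop :=
  J ≤ P ∧ ∀ (n : ℕ) (c : O.C n) (v : Fin n → A) (j : Fin n),
    (∀ k, v k ∈ P) → v j ∈ J → OA.α n c v ∈ J

/-- The multiplications (with `n ≥ 2`) of `A` do not all vanish on the subspace `P`. -/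
def HasNonzeroMul (OA : OperadAlgebraOn F O A) (P : Submodule F A) : Prop :=
  ∃ n : ℕ, 2 ≤ n ∧ ∃ (c : O.C n) (v : Fin n → A), (∀ k, v k ∈ P) ∧ OA.α n c v ≠ 0

/-- `P` is a simple summand: an ideal of `A`, with no nontrivial subideals,
on which the multiplication is nonzero. -/
def IsSimplePiece (OA : OperadAlgebraOn F O A) (P : Submodule F A) : Prop :=
  IsIdealPred OA P ∧ (∀ J ≤ P, IsIdealPred OA J → J = ⊥ ∨ J = P) ∧ HasNonzeroMul OA P

/-- `A` is a simple `C`-algebra: the only ideals are `0` and `A`, and `E_A ≠ 0`. -/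
def IsSimpleAlg (OA : OperadAlgebraOn F O A) : Prop :=
  (∀ I : Submodule F A, IsIdealPred OA I → I = ⊥ ∨ I = ⊤) ∧ EA OA ≠ ⊥

/-- `A` is a semisimple `C`-algebra: a finite direct sum of simple `C`-algebras. -/
def IsSemisimpleAlg (OA : OperadAlgebraOn F O A) : Prop :=
  ∃ (m : ℕ) (P : Fin m → Submodule F A),
    iSupIndep P ∧ (⨆ i, P i) = ⊤ ∧ ∀ i, IsSimplePiece OA (P i)

/-- The group of `C`-algebra automorphisms of `A`, as a subgroup of `A ≃ₗ[F] A`. -/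
def AlgAutGroup (OA : OperadAlgebraOn F O A) : Subgroup (A ≃ₗ[F] A) where
  carrier := {f | ∀ (n : ℕ) (c : O.C n) (v : Fin n → A),
    f (OA.α n c v) = OA.α n c (fun k => f (v k))}
  one_mem' := by intro n c v; rfl
  mul_mem' := by
    intro f g hf hg n c v
    show f (g (OA.α n c v)) = _
    rw [hg, hf]
    rfl
  inv_mem' := by
    intro f hf n c v
    have h1 : ∀ x : A, f (f⁻¹ x) = x := fun x => f.apply_symm_apply x
    apply f.injective
    rw [h1, hf]
    simp only [h1]

/-- A maximal (proper) ideal of `A`. -/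
def IsMaxIdeal (OA : OperadAlgebraOn F O A) (M : Submodule F A) : Prop :=
  IsIdealPred OA M ∧ M ≠ ⊤ ∧ ∀ J, IsIdealPred OA J → M < J → J = ⊤

/-- The kernel of the projection to the maximal semisimple quotient of `A`
as an `R_A`-module (the intersection of the maximal ideals). -/
def preRad (OA : OperadAlgebraOn F O A) : Submodule F A :=
  sInf {M | IsMaxIdeal OA M}

/-- The radical of the `C`-algebra `A`: the kernel of `A → Ā`, where `Ā` is the quotient of
the maximal semisimple `R_A`-module quotient `A' = A / preRad` by the kernel of the
`E_A`-action. -/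
def radAlg (OA : OperadAlgebraOn F O A) : Submodule F A :=
  ⨅ (e : Module.End F A) (_ : e ∈ EA OA), (preRad OA).comap e

/-- An operad algebra structure on `A ⧸ I` compatible with the projection. -/
def IsQuotientAlg (OA : OperadAlgebraOn F O A) (I : Submodule F A)
    (OQ : OperadAlgebraOn F O (A ⧸ I)) : Prop :=
  ∀ (n : ℕ) (c : O.C n) (v : Fin n → A),
    I.mkQ (OA.α n c v) = OQ.α n c (fun k => I.mkQ (v k))

/-- A componentwise ("pointwise") operad algebra structure on a product. -/
def IsComponentwiseAlg {ι : Type} {B : ι → Type} [∀ i, AddCommGroup (B i)]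
    [∀ i, Module F (B i)] (OB : ∀ i, OperadAlgebraOn F O (B i))
    (OP : OperadAlgebraOn F O (∀ i, B i)) : Prop :=
  ∀ (n : ℕ) (c : O.C n) (v : Fin n → ∀ i, B i) (i : ι),
    OP.α n c v i = (OB i).α n c (fun k => v k i)

/-- Pointwise algebra structure on `ι → B`. -/
def IsPointwiseAlg {ι B : Type} [AddCommGroup B] [Module F B]
    (OB : OperadAlgebraOn F O B) (OP : OperadAlgebraOn F O (ι → B)) : Prop :=
  ∀ (n : ℕ) (c : O.C n) (v : Fin n → ι → B) (i : ι),
    OP.α n c v i = OB.α n c (fun k => v k i)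

/-- Block-diagonal inclusion `End(B i) → End(Π j, B j)`. -/
def blkMap {ι : Type} [DecidableEq ι] (B : ι → Type) [∀ i, AddCommGroup (B i)]
    [∀ i, Module F (B i)] (i : ι) :
    Module.End F (B i) →ₗ[F] Module.End F (∀ j, B j) where
  toFun T := (LinearMap.single F B i) ∘ₗ T ∘ₗ (LinearMap.proj i)
  map_add' := by
    intro T S
    ext v j
    simp [Pi.single_add]
  map_smul' := by
    intro t T
    ext v j
    simp [Pi.single_smul]

/-- The action of `Perm ι` on `ι → K` by permuting coordinates. -/
def permAct (ι K : Type) [Group K] : Equiv.Perm ι →* MulAut (ι → K) where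
  toFun σ :=
    { toFun := fun f => f ∘ σ.symm
      invFun := fun f => f ∘ σ
      left_inv := fun f => by funext x; simp
      right_inv := fun f => by funext x; simp
      map_mul' := fun f g => rfl }
  map_one' := by
    ext f x
    rfl
  map_mul' := by
    intro σ τ
    ext f x
    rfl

/-- Right translation action of `G` on `G → B`. -/
def rightTrans (G B : Type) [Group G] (g : G) : (G → B) → (G → B) :=
  fun f x => f (x * g)

/-- The space `Fun_H(G, B)` of `H`-equivariant functions `G → B`. -/
def FunHsub (G : Type) [Group G] (B : Type) [AddCommGroup B] [Module F B]
    (H : Subgroup G) (OB : OperadAlgebraOn F O B) (φ : H →* AlgAutGroup OB) :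
    Submodule F (G → B) where
  carrier := {f | ∀ (h : H) (x : G),
    f ((h : G) * x) = ((φ h : AlgAutGroup OB) : B ≃ₗ[F] B) (f x)}
  add_mem' := by
    intro f g hf hg h x
    simp [hf h x, hg h x]
  zero_mem' := by intro h x; simp
  smul_mem' := by
    intro t f hf h x
    simp [hf h x]

/-- A bundled `C`-algebra (used for existential quantification over algebras). -/
structure OperadAlgBundle (F : Type) [Field F] (O : LinearOperadData F) where
  carrier : Type
  [acg : AddCommGroup carrier]
  [mod : Module F carrier]
  alg : OperadAlgebraOn F O carrier

attribute [instance] OperadAlgBundle.acg OperadAlgBundle.mod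

/-- `(A, ρ)` is modeled by `Fun_H(G, B)` for the pair `(H, φ)`:
there is an injective `G`-equivariant `C`-algebra map of `A` onto the subalgebra
`Fun_H(G, B)` of the pointwise algebra `G → B`, where `B` is simple and `G` acts by
right translation. -/
def IsFunHModel {G : Type} [Group G] (OA : OperadAlgebraOn F O A)
    (ρ : G →* (A ≃ₗ[F] A)) (H : Subgroup G) (Bb : OperadAlgBundle F O)
    (φ : H →* AlgAutGroup Bb.alg) : Prop :=
  IsSimpleAlg Bb.alg ∧
  ∃ OGB : OperadAlgebraOn F O (G → Bb.carrier),
    IsPointwiseAlg Bb.alg OGB ∧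
    ∃ e : A →ₗ[F] (G → Bb.carrier), Function.Injective e ∧
      LinearMap.range e = FunHsub G Bb.carrier H Bb.alg φ ∧
      (∀ (n : ℕ) (c : O.C n) (v : Fin n → A),
        e (OA.α n c v) = OGB.α n c fun k => e (v k)) ∧
      (∀ (g : G) (a : A) (x : G), e (ρ g a) x = e a (x * g))

/-- The composite of two partial multiplication operators is again one. -/
theorem OperadAlgebraOn.exists_op_eq_mul (OA : OperadAlgebraOn F O A) {m n : ℕ}
    (c : O.C m) (v : Fin m → A) (j : Fin m) (d : O.C n) (w : Fin n → A) (k : Fin n) :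
    ∃ (c' : O.C (m + n - 1)) (u : Fin (m + n - 1) → A) (l : Fin (m + n - 1)),
      OA.op c v j * OA.op d w k = OA.op c' u l := by
  have hj := j.isLt
  have hk := k.isLt
  refine ⟨O.comp c d j, fun l =>
    if h1 : (l : ℕ) < j then v ⟨l, by omega⟩
    else if h2 : (l : ℕ) < j + n then w ⟨l - j, by omega⟩
    else v ⟨l - n + 1, by have := l.isLt; omega⟩, ⟨j + k, by omega⟩, ?_⟩
  ext a
  simp only [OperadAlgebraOn.op, Module.End.mul_apply, MultilinearMap.toLinearMap_apply,
    OA.α_comp]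
  congr 1
  funext x
  have hx := x.isLt
  rcases lt_trichotomy (x : ℕ) (j : ℕ) with h | h | h
  · have hne : x ≠ j := fun e => by simp [e] at h
    have hne' : (⟨x, by omega⟩ : Fin (m + n - 1)) ≠ ⟨j + k, by omega⟩ := by
      simp only [ne_eq, Fin.mk.injEq]; omega
    simp [h, Function.update_of_ne hne, Function.update_of_ne hne']
  · obtain rfl : x = j := Fin.ext h
    simp only [Function.update_self, lt_irrefl, dite_false, dite_true]
    congr 1
    funext y
    have hy := y.isLt
    by_cases hyk : y = k
    · subst hyk
      simp
    · have hne' : (⟨x + y, by omega⟩ : Fin (m + n - 1)) ≠ ⟨x + k, by omega⟩ := by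
        simp only [ne_eq, Fin.mk.injEq]
        intro e
        exact hyk (Fin.ext (by omega))
      simp [Function.update_of_ne hyk, Function.update_of_ne hne']
  · have hne : x ≠ j := fun e => by simp [e] at h
    have hne' : (⟨x + n - 1, by omega⟩ : Fin (m + n - 1)) ≠ ⟨j + k, by omega⟩ := by
      simp only [ne_eq, Fin.mk.injEq]; omega
    have e : (x : ℕ) + n - 1 - n + 1 = x := by omega
    rw [Function.update_of_ne hne, dif_neg (by omega), dif_neg (by omega),
      Function.update_of_ne hne', dif_neg (by simp only; omega), dif_neg (by simp only; omega)]
    simp [e]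

theorem OperadAlgebraOn.op_mem_EA (OA : OperadAlgebraOn F O A) {n : ℕ} (hn : 2 ≤ n)
    (c : O.C n) (v : Fin n → A) (j : Fin n) : OA.op c v j ∈ EA OA :=
  Submodule.subset_span ⟨n, hn, c, v, j, rfl⟩

theorem OperadAlgebraOn.op_mul_mem_EA (OA : OperadAlgebraOn F O A) {n : ℕ}
    (c : O.C n) (v : Fin n → A) (j : Fin n) {e : Module.End F A} (he : e ∈ EA OA) :
    OA.op c v j * e ∈ EA OA := by
  induction he using Submodule.span_induction with
  | mem x hx =>
    obtain ⟨p, hp, d, w, k, rfl⟩ := hx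
    obtain ⟨c', u, l, h⟩ := OA.exists_op_eq_mul c v j d w k
    rw [h]
    exact OA.op_mem_EA (by have := j.isLt; omega) c' u l
  | zero => simp
  | add x y _ _ hx hy => rw [mul_add]; exact add_mem hx hy
  | smul a x _ hx => rw [mul_smul_comm]; exact Submodule.smul_mem _ a hx

theorem OperadAlgebraOn.mul_op_mem_EA (OA : OperadAlgebraOn F O A) {n : ℕ}
    (c : O.C n) (v : Fin n → A) (j : Fin n) {e : Module.End F A} (he : e ∈ EA OA) :
    e * OA.op c v j ∈ EA OA := by
  induction he using Submodule.span_induction with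
  | mem x hx =>
    obtain ⟨p, hp, d, w, k, rfl⟩ := hx
    obtain ⟨c', u, l, h⟩ := OA.exists_op_eq_mul d w k c v j
    rw [h]
    exact OA.op_mem_EA (by have := j.isLt; omega) c' u l
  | zero => simp
  | add x y _ _ hx hy => rw [add_mul]; exact add_mem hx hy
  | smul a x _ hx => rw [smul_mul_assoc]; exact Submodule.smul_mem _ a hx

theorem mul_mem_EA (OA : OperadAlgebraOn F O A) {e f : Module.End F A}
    (he : e ∈ EA OA) (hf : f ∈ EA OA) : e * f ∈ EA OA := by
  induction he using Submodule.span_induction with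
  | mem x hx =>
    obtain ⟨p, hp, d, w, k, rfl⟩ := hx
    exact OA.op_mul_mem_EA d w k hf
  | zero => simp
  | add x y _ _ hx hy => rw [add_mul]; exact add_mem hx hy
  | smul a x _ hx => rw [smul_mul_assoc]; exact Submodule.smul_mem _ a hx

/-- An ideal is exactly a subspace stable under all partial multiplication operators. -/
theorem isIdealPred_iff_op (OA : OperadAlgebraOn F O A) (I : Submodule F A) :
    IsIdealPred OA I ↔
      ∀ (n : ℕ) (c : O.C n) (v : Fin n → A) (j : Fin n), ∀ x ∈ I, OA.op c v j x ∈ I := by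
  constructor
  · intro h n c v j x hx
    exact h n c (Function.update v j x) j (by simpa using hx)
  · intro h n c v j hv
    simpa [OperadAlgebraOn.op] using h n c v j (v j) hv

theorem IsIdealPred.apply_mem {OA : OperadAlgebraOn F O A} {I : Submodule F A}
    (hI : IsIdealPred OA I) {e : Module.End F A} (he : e ∈ EA OA) {x : A} (hx : x ∈ I) :
    e x ∈ I := by
  induction he using Submodule.span_induction with
  | mem f hf =>
    obtain ⟨p, hp, d, w, k, rfl⟩ := hf
    exact (isIdealPred_iff_op OA I).1 hI p d w k x hx
  | zero => simp
  | add f g _ _ hf hg => exact add_mem hf hg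
  | smul a f _ hf => exact Submodule.smul_mem _ a hf

/-- A subspace of `E_A` stable under multiplication by the partial multiplication operators on
both sides, and not annihilating the simple summand `P`, acts transitively on nonzero vectors
of `P`. -/
theorem IsSimplePiece.exists_apply_eq {OA : OperadAlgebraOn F O A} {P : Submodule F A}
    (hP : IsSimplePiece OA P) {E : Submodule F (Module.End F A)} (hE : E ≤ EA OA)
    (hleft : ∀ (n : ℕ) (c : O.C n) (v : Fin n → A) (j : Fin n), ∀ e ∈ E, OA.op c v j * e ∈ E)
    (hright : ∀ (n : ℕ) (c : O.C n) (v : Fin n → A) (j : Fin n), ∀ e ∈ E, e * OA.op c v j ∈ E)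
    (hne : ∃ e ∈ E, ∃ x ∈ P, e x ≠ 0) {x y : A} (hx : x ∈ P) (hx0 : x ≠ 0) (hy : y ∈ P) :
    ∃ e ∈ E, e x = y := by
  have hPop := (isIdealPred_iff_op OA P).1 hP.1
  let N : Submodule F A := E.map (LinearMap.applyₗ x)
  have hNP : N ≤ P := by
    rintro _ ⟨e, he, rfl⟩
    exact hP.1.apply_mem (hE he) hx
  have hN : IsIdealPred OA N := by
    rw [isIdealPred_iff_op]
    rintro n c v j _ ⟨e, he, rfl⟩
    exact ⟨_, hleft n c v j e he, rfl⟩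
  rcases hP.2.1 N hNP hN with h | h
  · exfalso
    let Z : Submodule F A := P ⊓ ⨅ e ∈ E, LinearMap.ker e
    have hmem : ∀ z, z ∈ Z ↔ z ∈ P ∧ ∀ e ∈ E, e z = 0 := fun z => by simp [Z]
    have hZ : IsIdealPred OA Z := by
      rw [isIdealPred_iff_op]
      intro n c v j z hz
      rw [hmem] at hz ⊢
      exact ⟨hPop n c v j z hz.1, fun e he => hz.2 _ (hright n c v j e he)⟩
    have hxZ : x ∈ Z := (hmem x).2 ⟨hx, fun e he => by
      have : e x ∈ N := ⟨e, he, rfl⟩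
      simpa [h] using this⟩
    rcases hP.2.1 Z inf_le_left hZ with h' | h'
    · rw [h'] at hxZ
      exact hx0 (by simpa using hxZ)
    · obtain ⟨e, he, z, hz, hez⟩ := hne
      rw [← h'] at hz
      exact hez (((hmem z).1 hz).2 e he)
  · rw [← h] at hy
    obtain ⟨e, he, hey⟩ := hy
    exact ⟨e, he, hey⟩

/-- A multiplicatively closed space of operators preserving a finite-dimensional subspace `P` and
fixing each vector of `P` by some element contains an element fixing `P` pointwise. -/
theorem exists_mem_forall_apply_eq_self [FiniteDimensional F A] {P : Submodule F A}
    {E : Submodule F (Module.End F A)} (hmul : ∀ e ∈ E, ∀ f ∈ E, e * f ∈ E)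
    (hmaps : ∀ e ∈ E, ∀ x ∈ P, e x ∈ P) (hfix : ∀ x ∈ P, ∃ e ∈ E, e x = x) :
    ∃ e ∈ E, ∀ x ∈ P, e x = x := by
  let S : Set (Submodule F A) := (fun e => LinearMap.ker (1 - e)) '' (E : Set (Module.End F A))
  obtain ⟨_, ⟨e, he, rfl⟩, hmax⟩ :=
    WellFounded.has_min (wellFounded_gt (α := Submodule F A)) S ⟨_, 0, E.zero_mem, rfl⟩
  refine ⟨e, he, fun x hx => ?_⟩
  by_contra hex
  obtain ⟨f, hf, hfx⟩ := hfix (x - e x) (P.sub_mem hx (hmaps e he x hx))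
  have key : ∀ z, (1 - (e + (f - f * e))) z = (z - e z) - f (z - e z) := fun z => by
    simp only [LinearMap.sub_apply, LinearMap.add_apply, Module.End.one_apply,
      Module.End.mul_apply, map_sub]
    abel
  refine hmax _ ⟨e + (f - f * e), E.add_mem he (E.sub_mem hf (hmul f hf e he)), rfl⟩ ?_
  refine lt_of_le_of_ne (fun z hz => ?_) fun h => hex ?_
  · have hz' : z - e z = 0 := hz
    change (1 - (e + (f - f * e))) z = 0
    rw [key, hz']
    simp
  · have hx' : x ∈ LinearMap.ker (1 - (e + (f - f * e))) := by
      rw [LinearMap.mem_ker, key, hfx, sub_self]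
    have hx'' : x ∈ LinearMap.ker (1 - e) := h.symm.le hx'
    exact (sub_eq_zero.1 (show x - e x = 0 from hx'')).symm

/-- in a semisimple algebra `A = A₁ ⊕ ... ⊕ A_m`, the projection onto
each simple summand `A_i` along the other summands lies in `E_A`. -/
theorem projections_in_EA {F : Type} [Field F] {O : LinearOperadData F}
    {A : Type} [AddCommGroup A] [Module F A] [FiniteDimensional F A]
    (OA : OperadAlgebraOn F O A)
    {m : ℕ} (Ai : Fin m → Submodule F A)
    (hindep : iSupIndep Ai) (hsup : (⨆ i, Ai i) = ⊤)
    (hsimple : ∀ i, IsSimplePiece OA (Ai i)) :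
    ∀ i : Fin m, ∃ p ∈ EA OA, (∀ x ∈ Ai i, p x = x) ∧
      ∀ j : Fin m, j ≠ i → ∀ x ∈ Ai j, p x = 0 := by
  intro i
  have hideal := fun j => (hsimple j).1
  let E : Submodule F (Module.End F A) :=
    { carrier := {e | e ∈ EA OA ∧ ∀ j : Fin m, j ≠ i → ∀ x ∈ Ai j, e x = 0}
      add_mem' := fun ha hb => ⟨add_mem ha.1 hb.1, fun j hj x hx => by
        simp [ha.2 j hj x hx, hb.2 j hj x hx]⟩
      zero_mem' := ⟨zero_mem _, fun _ _ _ _ => rfl⟩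
      smul_mem' := fun t a ha => ⟨Submodule.smul_mem _ t ha.1, fun j hj x hx => by
        simp [ha.2 j hj x hx]⟩ }
  have hE : E ≤ EA OA := fun e he => he.1
  have hleft : ∀ (n : ℕ) (c : O.C n) (v : Fin n → A) (j : Fin n),
      ∀ e ∈ E, OA.op c v j * e ∈ E := fun n c v j e he =>
    ⟨OA.op_mul_mem_EA c v j he.1, fun k hk x hx => by simp [he.2 k hk x hx]⟩
  have hright : ∀ (n : ℕ) (c : O.C n) (v : Fin n → A) (j : Fin n),
      ∀ e ∈ E, e * OA.op c v j ∈ E := fun n c v j e he =>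
    ⟨OA.mul_op_mem_EA c v j he.1, fun k hk x hx =>
      he.2 k hk _ ((isIdealPred_iff_op OA _).1 (hideal k) n c v j x hx)⟩
  have hne : ∃ e ∈ E, ∃ x ∈ Ai i, e x ≠ 0 := by
    obtain ⟨n, hn, c, v, hv, hcv⟩ := (hsimple i).2.2
    refine ⟨OA.op c v ⟨0, by omega⟩, ⟨OA.op_mem_EA hn c v _, fun j hj x hx => ?_⟩,
      v ⟨0, by omega⟩, hv _, by simpa [OperadAlgebraOn.op] using hcv⟩
    have hxj := (isIdealPred_iff_op OA _).1 (hideal j) n c v ⟨0, by omega⟩ x hx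
    have hxi : OA.op c v ⟨0, by omega⟩ x ∈ Ai i :=
      hideal i n c (Function.update v ⟨0, by omega⟩ x) ⟨1, by omega⟩ (by
        rw [Function.update_of_ne (by simp)]
        exact hv _)
    exact Submodule.disjoint_def.1 (hindep.pairwiseDisjoint hj) _ hxj hxi
  have hmul : ∀ e ∈ E, ∀ f ∈ E, e * f ∈ E := fun e he f hf =>
    ⟨mul_mem_EA OA he.1 hf.1, fun k hk x hx => by simp [hf.2 k hk x hx]⟩
  have hfix : ∀ x ∈ Ai i, ∃ e ∈ E, e x = x := fun x hx => by
    by_cases hx0 : x = 0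
    · exact ⟨0, E.zero_mem, by simp [hx0]⟩
    · exact (hsimple i).exists_apply_eq hE hleft hright hne hx hx0 hx
  obtain ⟨p, hp, hpx⟩ := exists_mem_forall_apply_eq_self hmul
    (fun e he x hx => (hideal i).apply_mem (hE he) hx) hfix
  exact ⟨p, hp.1, hpx, hp.2⟩
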